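/- The map Cal₁ : Diff¹_ω(D) → ℝ is not continuous at the identity with respect to the C⁰ distance d₀: there exist ε > 0 and a sequence (f_n)_{n≥1} in Diff¹_ω(D), where each f_n is C^∞ and equals the identity outside the ball of radius 1/n centered at the origin (in particular d₀(f_n, id) → 0), such that |Cal₁(f_n)| ≥ ε for every n. -/

import Mathlib

open MeasureTheory Metric Set Filter Topology
open scoped Real

noncomputable section

/-- The closed unit disk in `ℂ ≅ ℝ²`. -/
def Disk : Set ℂ := Metric.closedBall 0 1

/-- The unit circle, boundary of the closed unit disk. -/
def Circ : Set ℂ := Metric.sphere 0 1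

/-- The standard Liouville form `λ_z(w) = (z₁ w₂ - z₂ w₁)/(2π)`, whose exterior
derivative is the normalized area form `ω = (1/π) du ∧ dv`. -/
def lform (z w : ℂ) : ℝ := (z.re * w.im - z.im * w.re) / (2 * Real.pi)

/-- An element of `Diff¹_ω(D)`: a `C¹` diffeomorphism of the closed unit disk onto itself
whose Jacobian determinant equals `1` at every point. -/
structure SympDiff where
  toFun : ℂ → ℂ
  invFun : ℂ → ℂ
  mapsTo : Set.MapsTo toFun Disk Disk
  inv_mapsTo : Set.MapsTo invFun Disk Disk
  left_inv : ∀ z ∈ Disk, invFun (toFun z) = z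
  right_inv : ∀ z ∈ Disk, toFun (invFun z) = z
  contDiffOn : ContDiffOn ℝ 1 toFun Disk
  inv_contDiffOn : ContDiffOn ℝ 1 invFun Disk
  jacobian : ∀ z ∈ Disk,
    LinearMap.det (fderivWithin ℝ toFun Disk z).toLinearMap = 1

/-- `A` is an action function of `f`: a `C¹` function with `dA = f*λ - λ` on the disk. -/
def IsAction (f : SympDiff) (A : ℂ → ℝ) : Prop :=
  ContDiffOn ℝ 1 A Disk ∧
    ∀ z ∈ Disk, ∀ w : ℂ,
      fderivWithin ℝ A Disk z w =
        lform (f.toFun z) (fderivWithin ℝ f.toFun Disk z w) - lform z w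

/-- `μ` is a Borel probability measure concentrated on the unit circle and invariant
under `f|_{S¹}`. -/
def IsInvariantCircleMeasure (f : SympDiff) (μ : Measure ℂ) : Prop :=
  IsProbabilityMeasure μ ∧ μ Circᶜ = 0 ∧ Measure.map f.toFun μ = μ

/-- `A` is a normalized action function of `f`: an action function whose integral over the
circle with respect to some `f|_{S¹}`-invariant probability measure vanishes. -/
def IsNormalizedAction (f : SympDiff) (A : ℂ → ℝ) : Prop :=
  IsAction f A ∧
    ∃ μ : Measure ℂ, IsInvariantCircleMeasure f μ ∧ ∫ z, A z ∂μ = 0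

/-- The `C⁰` distance between two disk diffeomorphisms (given with their inverses). -/
def d0 (f fi g gi : ℂ → ℂ) : ℝ :=
  max (⨆ z : Disk, ‖f (z : ℂ) - g (z : ℂ)‖) (⨆ z : Disk, ‖fi (z : ℂ) - gi (z : ℂ)‖)

/-- The `C¹` distance between two disk diffeomorphisms (given with their inverses). -/
def d1 (f fi g gi : ℂ → ℂ) : ℝ :=
  max (d0 f fi g gi)
    (max (⨆ z : Disk, ‖fderivWithin ℝ f Disk (z : ℂ) - fderivWithin ℝ g Disk (z : ℂ)‖)
      (⨆ z : Disk, ‖fderivWithin ℝ fi Disk (z : ℂ) - fderivWithin ℝ gi Disk (z : ℂ)‖))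

/-- The twist map `z ↦ e^{iφ(|z|²)} z`. -/
def twist (φ : ℝ → ℝ) (z : ℂ) : ℂ := z * Complex.exp (φ (Complex.normSq z) * Complex.I)

/-- The differential of the twist map, where `a` is the rotation angle and `b` its derivative. -/
def twistDeriv (a b : ℝ) (z w : ℂ) : ℂ :=
  Complex.exp (a * Complex.I) *
    (w + z * (Complex.I * ((b * (2 * (z.re * w.re + z.im * w.im)) : ℝ) : ℂ)))

theorem uniqueDiffOn_disk : UniqueDiffOn ℝ Disk :=
  uniqueDiffOn_convex (convex_closedBall 0 1)
    ⟨0, by simp [Disk, interior_closedBall]⟩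

theorem contDiff_normSq {n : WithTop ℕ∞} : ContDiff ℝ n Complex.normSq := by
  have h : (Complex.normSq : ℂ → ℝ) = fun z => Complex.reCLM z * Complex.reCLM z +
      Complex.imCLM z * Complex.imCLM z := by
    ext z; simp [Complex.normSq_apply]
  rw [h]
  fun_prop

theorem hasFDerivAt_normSq (z : ℂ) :
    HasFDerivAt (Complex.normSq : ℂ → ℝ)
      ((2 * z.re) • Complex.reCLM + (2 * z.im) • Complex.imCLM) z := by
  have h : (Complex.normSq : ℂ → ℝ) = fun z => Complex.reCLM z * Complex.reCLM z +
      Complex.imCLM z * Complex.imCLM z := by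
    ext z; simp [Complex.normSq_apply]
  rw [h]
  have hr := Complex.reCLM.hasFDerivAt (x := z)
  have hi := Complex.imCLM.hasFDerivAt (x := z)
  refine ((hr.mul hr).add (hi.mul hi)).congr_fderiv ?_
  ext w
  simp
  ring

theorem contDiff_twist {n : WithTop ℕ∞} {φ : ℝ → ℝ} (hφ : ContDiff ℝ n φ) :
    ContDiff ℝ n (twist φ) := by
  have h : ContDiff ℝ n fun z : ℂ => (φ (Complex.normSq z) : ℂ) :=
    Complex.ofRealCLM.contDiff.comp (hφ.comp contDiff_normSq)
  exact contDiff_id.mul (h.mul contDiff_const).cexp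

theorem normSq_twist (φ : ℝ → ℝ) (z : ℂ) :
    Complex.normSq (twist φ z) = Complex.normSq z := by
  simp [twist, Complex.normSq_eq_norm_sq, Complex.norm_exp_ofReal_mul_I]

theorem twist_mapsTo (φ : ℝ → ℝ) : MapsTo (twist φ) Disk Disk := by
  intro z hz
  simpa [Disk, twist, Complex.norm_exp_ofReal_mul_I] using hz

theorem twist_neg_twist (φ : ℝ → ℝ) (z : ℂ) : twist (-φ) (twist φ z) = z := by
  rw [twist, normSq_twist, twist, mul_assoc, ← Complex.exp_add]
  simp

theorem fderivWithin_twist {φ : ℝ → ℝ} {b : ℝ} {z : ℂ} (hz : z ∈ Disk)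
    (hφ : HasDerivAt φ b (Complex.normSq z)) (w : ℂ) :
    fderivWithin ℝ (twist φ) Disk z w = twistDeriv (φ (Complex.normSq z)) b z w := by
  have h1 : HasFDerivAt (fun y : ℂ => (φ (Complex.normSq y) : ℂ)) _ z :=
    Complex.ofRealCLM.hasFDerivAt.comp z (hφ.comp_hasFDerivAt z (hasFDerivAt_normSq z))
  have h2 : HasFDerivAt (twist φ) _ z :=
    (hasFDerivAt_id (𝕜 := ℝ) z).mul (h1.mul_const Complex.I).cexp
  rw [h2.hasFDerivWithinAt.fderivWithin (uniqueDiffOn_disk z hz)]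
  simp [twistDeriv]
  ring

theorem exp_ofReal_mul_I_eq (a : ℝ) :
    Complex.exp (a * Complex.I) = ⟨Real.cos a, Real.sin a⟩ := by
  apply Complex.ext
  · exact Complex.exp_ofReal_mul_I_re a
  · exact Complex.exp_ofReal_mul_I_im a

theorem det_complex (L : ℂ →ₗ[ℝ] ℂ) :
    LinearMap.det L = (L 1).re * (L Complex.I).im - (L Complex.I).re * (L 1).im := by
  rw [← LinearMap.det_toMatrix Complex.basisOneI, Matrix.det_fin_two]
  simp [LinearMap.toMatrix_apply]

theorem lform_twist {φ : ℝ → ℝ} (b : ℝ) (z w : ℂ) :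
    lform (twist φ z) (twistDeriv (φ (Complex.normSq z)) b z w) - lform z w =
      Complex.normSq z * b * (2 * (z.re * w.re + z.im * w.im)) / (2 * π) := by
  have h := Real.cos_sq_add_sin_sq (φ (Complex.normSq z))
  unfold lform
  rw [← sub_div]
  congr 1
  simp only [twist, twistDeriv, exp_ofReal_mul_I_eq]
  generalize Real.cos (φ (Complex.normSq z)) = c at *
  generalize Real.sin (φ (Complex.normSq z)) = s at *
  simp only [Complex.mul_re, Complex.mul_im, Complex.add_re, Complex.add_im, Complex.I_re,
    Complex.I_im, Complex.ofReal_re, Complex.ofReal_im, Complex.normSq_apply]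
  obtain ⟨x, y⟩ := z
  obtain ⟨u, v⟩ := w
  simp only
  linear_combination
    (x * v - y * u + (x * x + y * y) * b * (2 * (x * u + y * v))) * h

/-- The twist map as an area-preserving diffeomorphism of the disk. -/
def twistDiff (φ : ℝ → ℝ) (hφ : ContDiff ℝ 1 φ) : SympDiff where
  toFun := twist φ
  invFun := twist (-φ)
  mapsTo := twist_mapsTo φ
  inv_mapsTo := twist_mapsTo (-φ)
  left_inv z _ := twist_neg_twist φ z
  right_inv z _ := by simpa using twist_neg_twist (-φ) z
  contDiffOn := (contDiff_twist hφ).contDiffOn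
  inv_contDiffOn := (contDiff_twist hφ.neg).contDiffOn
  jacobian z hz := by
    have hd := fderivWithin_twist hz
      ((hφ.differentiable (by norm_num)).differentiableAt (x := Complex.normSq z)).hasDerivAt
    rw [det_complex]
    simp only [ContinuousLinearMap.coe_coe, hd, twistDeriv, exp_ofReal_mul_I_eq]
    have h := Real.cos_sq_add_sin_sq (φ (Complex.normSq z))
    generalize Real.cos (φ (Complex.normSq z)) = c at *
    generalize Real.sin (φ (Complex.normSq z)) = s at *
    generalize deriv φ (Complex.normSq z) = b
    simp only [Complex.mul_re, Complex.mul_im, Complex.add_re, Complex.add_im, Complex.I_re,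
      Complex.I_im, Complex.ofReal_re, Complex.ofReal_im, Complex.one_re, Complex.one_im]
    linear_combination h

theorem IsAction.hasFDerivWithinAt {f : SympDiff} {A : ℂ → ℝ} (hA : IsAction f A) {z : ℂ}
    (hz : z ∈ Disk) : HasFDerivWithinAt A (fderivWithin ℝ A Disk z) Disk z :=
  (hA.1.differentiableOn (by norm_num) z hz).hasFDerivWithinAt

/-- If an action function vanishes on the boundary circle, it is the only normalized one. -/
theorem IsNormalizedAction.eqOn {f : SympDiff} {A H : ℂ → ℝ} (hA : IsNormalizedAction f A)
    (hH : IsAction f H) (h0 : ∀ z ∈ Circ, H z = 0) : EqOn A H Disk := by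
  obtain ⟨hA, μ, ⟨hp, hc, -⟩, hint⟩ := hA
  have hsub : Circ ⊆ Disk := sphere_subset_closedBall
  have hconst : ∀ z ∈ Disk, A z - H z = A 1 - H 1 := by
    intro z hz
    refine (convex_closedBall (0 : ℂ) 1).is_const_of_fderivWithin_eq_zero (𝕜 := ℝ)
      (f := fun z => A z - H z) (fun y hy => ?_) (fun y hy => ?_) hz (by simp)
    · exact ((hA.hasFDerivWithinAt hy).sub (hH.hasFDerivWithinAt hy)).differentiableWithinAt
    · refine (((hA.hasFDerivWithinAt hy).sub
        (hH.hasFDerivWithinAt hy)).fderivWithin (uniqueDiffOn_disk y hy)).trans ?_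
      ext w
      simp [hA.2 y hy, hH.2 y hy]
  have hae : A =ᵐ[μ] fun _ => A 1 - H 1 := by
    have : ∀ᵐ z ∂μ, z ∈ Circ := mem_ae_iff.2 hc
    filter_upwards [this] with z hz
    rw [← hconst z (hsub hz), h0 z hz, sub_zero]
  rw [integral_congr_ae hae] at hint
  simp only [integral_const, probReal_univ, one_smul] at hint
  intro z hz
  have := hconst z hz
  linarith

/-- A smooth cutoff equal to `1` on `(-∞, 1/2]` and to `0` on `[1, ∞)`. -/
def cutoff (v : ℝ) : ℝ := Real.smoothTransition (2 - 2 * v)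

theorem contDiff_cutoff {n : ℕ∞} : ContDiff ℝ n cutoff :=
  Real.smoothTransition.contDiff.comp (by fun_prop)

theorem cutoff_nonneg (v : ℝ) : 0 ≤ cutoff v := Real.smoothTransition.nonneg _

theorem cutoff_eq_zero {v : ℝ} (hv : 1 ≤ v) : cutoff v = 0 :=
  Real.smoothTransition.zero_of_nonpos (by linarith)

theorem cutoff_eq_one {v : ℝ} (hv : v ≤ 1 / 2) : cutoff v = 1 :=
  Real.smoothTransition.one_of_one_le (by linarith)

/-- The primitive of `v ↦ v * deriv cutoff v` vanishing on `[1, ∞)`. -/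
def profile (v : ℝ) : ℝ := v * cutoff v - ∫ t in (1 : ℝ)..v, cutoff t

theorem hasDerivAt_profile (v : ℝ) : HasDerivAt profile (v * deriv cutoff v) v := by
  have hc : Continuous cutoff := (contDiff_cutoff (n := 0)).continuous
  have h1 : HasDerivAt cutoff (deriv cutoff v) v :=
    ((contDiff_cutoff (n := 1)).differentiable (by norm_num) v).hasDerivAt
  have h2 : HasDerivAt (fun u => ∫ t in (1 : ℝ)..u, cutoff t) (cutoff v) v :=
    hc.integral_hasStrictDerivAt 1 v |>.hasDerivAt
  refine (((hasDerivAt_id v).mul h1).sub h2).congr_deriv ?_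
  simp

theorem contDiff_profile : ContDiff ℝ 1 profile := by
  refine contDiff_one_iff_deriv.2 ⟨fun v => (hasDerivAt_profile v).differentiableAt, ?_⟩
  rw [funext fun v => (hasDerivAt_profile v).deriv]
  exact continuous_id.mul ((contDiff_cutoff (n := 1)).continuous_deriv (by norm_num))

theorem profile_eq_zero {v : ℝ} (hv : 1 ≤ v) : profile v = 0 := by
  have : ∫ t in (1 : ℝ)..v, cutoff t = ∫ _ in (1 : ℝ)..v, (0 : ℝ) := by
    refine intervalIntegral.integral_congr fun t ht => ?_
    rw [uIcc_of_le hv] at ht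
    exact cutoff_eq_zero ht.1
  rw [profile, this, cutoff_eq_zero hv]
  simp

theorem profile_nonneg {v : ℝ} (hv : 0 ≤ v) : 0 ≤ profile v := by
  rcases le_total 1 v with h | h
  · rw [profile_eq_zero h]
  · rw [profile, intervalIntegral.integral_symm]
    have := intervalIntegral.integral_nonneg h (fun t _ => cutoff_nonneg t) (μ := volume)
    have := mul_nonneg hv (cutoff_nonneg v)
    linarith

theorem quarter_le_profile {v : ℝ} (h0 : 0 ≤ v) (hv : v ≤ 1 / 4) : 1 / 4 ≤ profile v := by
  have hc : Continuous cutoff := (contDiff_cutoff (n := 0)).continuous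
  have hsplit := intervalIntegral.integral_add_adjacent_intervals
    (hc.intervalIntegrable (μ := volume) v (1 / 2)) (hc.intervalIntegrable (1 / 2) 1)
  have h1 : ∫ t in v..(1 / 2 : ℝ), cutoff t = ∫ _ in v..(1 / 2 : ℝ), (1 : ℝ) := by
    refine intervalIntegral.integral_congr fun t ht => ?_
    rw [uIcc_of_le (by linarith)] at ht
    exact cutoff_eq_one ht.2
  rw [intervalIntegral.integral_const] at h1
  have h2 := intervalIntegral.integral_nonneg (by norm_num : (1 / 2 : ℝ) ≤ 1)
    (fun t _ => cutoff_nonneg t) (μ := volume)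
  have h3 := mul_nonneg h0 (cutoff_nonneg v)
  rw [profile, intervalIntegral.integral_symm]
  simp only [smul_eq_mul, mul_one] at h1
  linarith

/-- The rotation angle, as a function of `|z|²`, of a twist supported in the ball of
radius `1/k`. -/
def angle (k s : ℝ) : ℝ := k ^ 4 * cutoff (k ^ 2 * s)

theorem contDiff_angle (k : ℝ) {n : ℕ∞} : ContDiff ℝ n (angle k) :=
  contDiff_const.mul (contDiff_cutoff.comp (contDiff_const.mul contDiff_id))

theorem hasDerivAt_angle (k s : ℝ) :
    HasDerivAt (angle k) (k ^ 6 * deriv cutoff (k ^ 2 * s)) s := by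
  have h1 : HasDerivAt cutoff _ (k ^ 2 * s) :=
    ((contDiff_cutoff (n := 1)).differentiable (by norm_num) _).hasDerivAt
  refine ((h1.comp s ((hasDerivAt_id s).const_mul (k ^ 2))).const_mul (k ^ 4)).congr_deriv ?_
  simp only [mul_one]
  ring

/-- The action function of the twist of angle `angle k`. -/
def twistAction (k : ℝ) (z : ℂ) : ℝ := k ^ 2 / (2 * π) * profile (k ^ 2 * Complex.normSq z)

theorem contDiff_twistAction (k : ℝ) : ContDiff ℝ 1 (twistAction k) :=
  contDiff_const.mul (contDiff_profile.comp (contDiff_const.mul contDiff_normSq))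

theorem isAction_twistAction (k : ℝ) :
    IsAction (twistDiff (angle k) (contDiff_angle k)) (twistAction k) := by
  refine ⟨(contDiff_twistAction k).contDiffOn, fun z hz w => ?_⟩
  have h1 : HasFDerivAt (twistAction k) _ z :=
    ((hasDerivAt_profile _).comp_hasFDerivAt z
      ((hasFDerivAt_normSq z).const_mul (k ^ 2))).const_mul (k ^ 2 / (2 * π))
  have h2 : fderivWithin ℝ (twist (angle k)) Disk z w = _ :=
    fderivWithin_twist hz (hasDerivAt_angle k _) w
  simp only [twistDiff]
  rw [h2, lform_twist, h1.hasFDerivWithinAt.fderivWithin (uniqueDiffOn_disk z hz)]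
  simp
  ring

theorem le_integral_twistAction {k : ℝ} (hk : 1 ≤ k) :
    1 / 32 ≤ ∫ z in Disk, twistAction k z := by
  have hk0 : 0 < k := by linarith
  have hr : 1 / (2 * k) ≤ 1 := by
    rw [div_le_one (by positivity)]; linarith
  have hint : IntegrableOn (twistAction k) Disk :=
    (contDiff_twistAction k).continuous.continuousOn.integrableOn_compact
      (isCompact_closedBall 0 1)
  have hsub : closedBall (0 : ℂ) (1 / (2 * k)) ⊆ Disk := closedBall_subset_closedBall hr
  have hnonneg : ∀ z, 0 ≤ twistAction k z := fun z =>
    mul_nonneg (by positivity) (profile_nonneg (mul_nonneg (by positivity)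
      (Complex.normSq_nonneg z)))
  have hlow : ∀ z ∈ closedBall (0 : ℂ) (1 / (2 * k)), k ^ 2 / (8 * π) ≤ twistAction k z := by
    intro z hz
    rw [mem_closedBall_zero_iff] at hz
    have hv : k ^ 2 * Complex.normSq z ≤ 1 / 4 := by
      rw [Complex.normSq_eq_norm_sq]
      calc k ^ 2 * ‖z‖ ^ 2 ≤ k ^ 2 * (1 / (2 * k)) ^ 2 := by gcongr
        _ = 1 / 4 := by field_simp; norm_num
    calc k ^ 2 / (8 * π) = k ^ 2 / (2 * π) * (1 / 4) := by ring
      _ ≤ twistAction k z := mul_le_mul_of_nonneg_left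
        (quarter_le_profile (mul_nonneg (by positivity) (Complex.normSq_nonneg z)) hv)
        (by positivity)
  have hvol : volume.real (closedBall (0 : ℂ) (1 / (2 * k))) = (1 / (2 * k)) ^ 2 * π := by
    rw [Measure.real, Complex.volume_closedBall]
    simp [hk0.le]
  calc (1 / 32 : ℝ) = volume.real (closedBall (0 : ℂ) (1 / (2 * k))) * (k ^ 2 / (8 * π)) := by
        rw [hvol]; field_simp; norm_num
    _ = ∫ _ in closedBall (0 : ℂ) (1 / (2 * k)), k ^ 2 / (8 * π) := by
        rw [setIntegral_const, smul_eq_mul]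
    _ ≤ ∫ z in closedBall (0 : ℂ) (1 / (2 * k)), twistAction k z :=
        setIntegral_mono_on (integrableOn_const measure_closedBall_lt_top.ne)
          (hint.mono_set hsub) measurableSet_closedBall hlow
    _ ≤ ∫ z in Disk, twistAction k z :=
        setIntegral_mono_set hint (ae_of_all _ hnonneg) hsub.eventuallyLE

/-- `Cal₁` is not continuous at the identity for the `C⁰` distance:
there are smooth `F n ∈ Diff¹_ω(D)` supported in the ball of radius `1/n` whose Calabi
invariants stay away from `0`. -/
theorem cal_not_C0_continuous :
    ∃ ε : ℝ, 0 < ε ∧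
      ∃ F : ℕ → SympDiff,
        ∀ n : ℕ, 1 ≤ n →
          ContDiffOn ℝ (⊤ : ℕ∞) (F n).toFun Disk ∧
          ContDiffOn ℝ (⊤ : ℕ∞) (F n).invFun Disk ∧
          (∀ z ∈ Disk, (1 : ℝ) / n < ‖z‖ → (F n).toFun z = z) ∧
          ∀ A : ℂ → ℝ, IsNormalizedAction (F n) A →
            ε ≤ |(1 / Real.pi) * ∫ z in Disk, A z| := by
  refine ⟨1 / π * (1 / 32), by positivity,
    fun n => twistDiff (angle n) (contDiff_angle n), fun n hn => ?_⟩
  have hn1 : (1 : ℝ) ≤ n := by exact_mod_cast hn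
  have hn0 : (0 : ℝ) < n := by linarith
  refine ⟨(contDiff_twist (contDiff_angle n)).contDiffOn,
    (contDiff_twist (contDiff_angle n).neg).contDiffOn, fun z _ hz => ?_, fun A hA => ?_⟩
  · have hv : 1 ≤ (n : ℝ) ^ 2 * Complex.normSq z := by
      rw [Complex.normSq_eq_norm_sq, ← mul_pow]
      rw [div_lt_iff₀ hn0] at hz
      exact one_le_pow₀ (by linarith)
    simp [twistDiff, twist, angle, cutoff_eq_zero hv]
  · have hEq := hA.eqOn (isAction_twistAction n) fun z hz => by
      rw [Circ, mem_sphere_zero_iff_norm] at hz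
      rw [twistAction, profile_eq_zero, mul_zero]
      rw [Complex.normSq_eq_norm_sq, hz]
      simpa using hn
    rw [setIntegral_congr_fun (s := Disk) measurableSet_closedBall hEq]
    exact (mul_le_mul_of_nonneg_left (le_integral_twistAction hn1) (by positivity)).trans
      (le_abs_self _)
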